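/- Fix real constants a1, a2, a3 and q0 ∈ ℝ. Set ν = ν*(q0) := −(8/5)a2 q0 + (3/10)a3² q0² and μ = μ_f(ν*(q0), q0), where μ_f(ν,q0) := (9/16)ν² − a1 q0 + (27/8)a2 ν q0 + (27/8)a2² q0² + (27/4)a3² ν q0² + (45/4)a2 a3² q0³ + (135/16)a3⁴ q0⁴. Then for any κ, the Jacobian matrix J of F_{κ,μ,ν} at x*(q0) has characteristic polynomial X⁴; in particular J⁴ = 0, i.e. the equilibrium is nilpotent along this line where the fold and Hopf surfaces meet. -/

import Mathlib

open Polynomial Matrix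

noncomputable section

/-- The vector field of the order-3 truncated normal form Hamiltonian near a degree-4
nilpotent equilibrium, in coordinates (q1,q2,p1,p2) = (v 0, v 1, v 2, v 3). -/
def Fvf (a1 a2 a3 κ μ ν : ℝ) (v : Fin 4 → ℝ) : Fin 4 → ℝ :=
  ![ (3*a3/2)*(v 0)^2 - v 1,
     v 3 + (3*ν/4)*(v 0) + (3*a2/4)*(v 0)^2 + (3*a3/2)*(v 0)*(v 1),
     -κ - (3*ν/4)*(v 3) - μ*(v 0) - 3*a3*(v 2)*(v 0) - (3*a2/2)*(v 3)*(v 0)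
       - (a1/2)*(v 0)^2 - (3*a3/2)*(v 3)*(v 1) - (a2/2)*(v 1)^2,
     v 2 - (3*a3/2)*(v 3)*(v 0) - ν*(v 1) - a2*(v 0)*(v 1) - 2*a3*(v 1)^2 ]

/-- The equilibrium point x*(q0). -/
def xstar (a2 a3 ν q0 : ℝ) : Fin 4 → ℝ :=
  ![ q0,
     (3/2)*a3*q0^2,
     (3/8)*(a3*ν*q0^2 + a2*a3*q0^3 + 3*a3^3*q0^4),
     -(3/4)*(ν*q0 + a2*q0^2 + 3*a3^2*q0^3) ]

/-- The fold surface μ = μ_f(ν,q0). -/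
def muF (a1 a2 a3 ν q0 : ℝ) : ℝ :=
  (9/16)*ν^2 - a1*q0 + (27/8)*a2*ν*q0 + (27/8)*a2^2*q0^2 + (27/4)*a3^2*ν*q0^2
    + (45/4)*a2*a3^2*q0^3 + (135/16)*a3^4*q0^4

/-- The line ν = ν*(q0) along which the fold and Hopf surfaces meet. -/
def nuStar (a2 a3 q0 : ℝ) : ℝ := -(8/5)*a2*q0 + (3/10)*a3^2*q0^2

/-- The Jacobian matrix of a vector field F : ℝ⁴ → ℝ⁴ at a point x. -/
def jacobian (F : (Fin 4 → ℝ) → (Fin 4 → ℝ)) (x : Fin 4 → ℝ) :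
    Matrix (Fin 4) (Fin 4) ℝ :=
  Matrix.of fun i j => fderiv ℝ (fun y => F y i) x (Pi.single j 1)

theorem jac_eq (a1 a2 a3 κ μ ν : ℝ) (x : Fin 4 → ℝ) :
    jacobian (Fvf a1 a2 a3 κ μ ν) x =
    !![3*a3*x 0, -1, 0, 0;
       3*ν/4 + 3*a2/2*x 0 + 3*a3/2*x 1, 3*a3/2*x 0, 0, 1;
       -μ - 3*a3*x 2 - 3*a2/2*x 3 - a1*x 0, -(3*a3/2)*x 3 - a2*x 1, -3*a3*x 0,
         -(3*ν/4) - 3*a2/2*x 0 - 3*a3/2*x 1;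
       -(3*a3/2)*x 3 - a2*x 1, -ν - a2*x 0 - 4*a3*x 1, 1, -(3*a3/2)*x 0] := by
  have h : ∀ i : Fin 4, HasFDerivAt (fun y : Fin 4 → ℝ => y i)
      (ContinuousLinearMap.proj (R := ℝ) (φ := fun _ : Fin 4 => ℝ) i) x :=
    fun i => hasFDerivAt_apply i x
  have h0 := h 0
  have h1 := h 1
  have h2 := h 2
  have h3 := h 3
  have e0 := ((h0.pow 2).const_mul (3*a3/2)).fun_sub h1
  have e1 := ((h3.fun_add (h0.const_mul (3*ν/4))).fun_add
    ((h0.pow 2).const_mul (3*a2/4))).fun_add ((h0.const_mul (3*a3/2)).fun_mul h1)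
  have e2 := (((((((hasFDerivAt_const (-κ) x).fun_sub (h3.const_mul (3*ν/4))).fun_sub
    (h0.const_mul μ)).fun_sub ((h2.const_mul (3*a3)).fun_mul h0)).fun_sub
    ((h3.const_mul (3*a2/2)).fun_mul h0)).fun_sub ((h0.pow 2).const_mul (a1/2))).fun_sub
    ((h3.const_mul (3*a3/2)).fun_mul h1)).fun_sub ((h1.pow 2).const_mul (a2/2))
  have e3 := (((h2.fun_sub ((h3.const_mul (3*a3/2)).fun_mul h0)).fun_sub
    (h1.const_mul ν)).fun_sub ((h0.const_mul a2).fun_mul h1)).fun_sub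
    ((h1.pow 2).const_mul (2*a3))
  have f0 : fderiv ℝ (fun y => Fvf a1 a2 a3 κ μ ν y 0) x = _ := e0.fderiv
  have f1 : fderiv ℝ (fun y => Fvf a1 a2 a3 κ μ ν y 1) x = _ := e1.fderiv
  have f2 : fderiv ℝ (fun y => Fvf a1 a2 a3 κ μ ν y 2) x = _ := e2.fderiv
  have f3 : fderiv ℝ (fun y => Fvf a1 a2 a3 κ μ ν y 3) x = _ := e3.fderiv
  ext i j
  fin_cases i
  · simp only [jacobian, Matrix.of_apply, Fin.zero_eta, f0]
    fin_cases j <;> simp <;> ring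
  · simp only [jacobian, Matrix.of_apply, Fin.mk_one, f1]
    fin_cases j <;> simp <;> ring
  · simp only [jacobian, Matrix.of_apply, Fin.reduceFinMk, f2]
    fin_cases j <;> simp <;> ring
  · simp only [jacobian, Matrix.of_apply, Fin.reduceFinMk, f3]
    fin_cases j <;> simp <;> ring

theorem stmt_13 (a1 a2 a3 q0 κ : ℝ)
    (ν : ℝ) (hν : ν = nuStar a2 a3 q0)
    (μ : ℝ) (hμ : μ = muF a1 a2 a3 ν q0) :
    (jacobian (Fvf a1 a2 a3 κ μ ν) (xstar a2 a3 ν q0)).charpoly = X^4 ∧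
    (jacobian (Fvf a1 a2 a3 κ μ ν) (xstar a2 a3 ν q0))^4 = 0 := by
  have key : (jacobian (Fvf a1 a2 a3 κ μ ν) (xstar a2 a3 ν q0)).charpoly = X^4 := by
    apply Polynomial.funext
    intro t
    rw [Matrix.eval_charpoly, jac_eq]
    simp [Matrix.det_succ_row_zero, Fin.sum_univ_succ, xstar, Fin.succAbove, Matrix.scalar_apply]
    subst hμ
    subst hν
    simp only [muF, nuStar]
    ring
  refine ⟨key, ?_⟩
  have := Matrix.aeval_self_charpoly (jacobian (Fvf a1 a2 a3 κ μ ν) (xstar a2 a3 ν q0))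
  rw [key] at this
  simpa using this
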